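/- Let (a,b,c,d) ∈ ℝ⁴ satisfy the Descartes equation 2(a²+b²+c²+d²) = (a+b+c+d)², with a ≤ b ≤ c ≤ d and a+b+c+d > 0. Then for each j ∈ {1,2,3,4}, the sum of the entries of Sⱼ·(a,b,c,d)ᵀ is strictly positive; in particular, with d' = 2(a+b+c) − d one has a+b+c+d' > 0. -/

import Mathlib

/-- The generators `S₁, S₂, S₃, S₄` of the Apollonian group, as real matrices.
`S i` agrees with the identity except in row `i`, which has `-1` on the diagonal
and `2` in the other positions. -/
def SR (i : Fin 4) : Matrix (Fin 4) (Fin 4) ℝ :=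
  Matrix.of fun k l => if k = i then (if l = i then -1 else 2) else (if k = l then 1 else 0)

/-- In a Descartes quadruple with positive sum, each entry is less than three times
the sum of the other three. -/
lemma descartes_lt_three_mul_sum (x p q r : ℝ)
    (hD : 2 * (x ^ 2 + p ^ 2 + q ^ 2 + r ^ 2) = (x + p + q + r) ^ 2)
    (hsum : 0 < x + p + q + r) : x < 3 * (p + q + r) := by
  by_contra! h
  have hv : 0 ≤ x - 3 * (p + q + r) := by linarith
  nlinarith [mul_nonneg hsum.le hv, mul_pos hsum hsum, sq_nonneg (x - 3 * (p + q + r)),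
    sq_nonneg (p - q), sq_nonneg (q - r), sq_nonneg (p - r)]

/-- If `(a,b,c,d)` is a real Descartes quadruple with `a ≤ b ≤ c ≤ d` and
`a+b+c+d > 0`, then the entry-sum of `Sⱼ·(a,b,c,d)ᵀ` is strictly positive for
each `j`; in particular, with `d' = 2(a+b+c) - d`, one has `a+b+c+d' > 0`. -/
theorem descartes_S_sum_pos (a b c d : ℝ)
    (hD : 2 * (a ^ 2 + b ^ 2 + c ^ 2 + d ^ 2) = (a + b + c + d) ^ 2)
    (hab : a ≤ b) (hbc : b ≤ c) (hcd : c ≤ d) (hsum : 0 < a + b + c + d) :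
    (∀ j : Fin 4, 0 < ∑ i, ((SR j).mulVec ![a, b, c, d]) i) ∧
    0 < a + b + c + (2 * (a + b + c) - d) := by
  have ha := descartes_lt_three_mul_sum a b c d (by linarith) (by linarith)
  have hb := descartes_lt_three_mul_sum b a c d (by linarith) (by linarith)
  have hc := descartes_lt_three_mul_sum c a b d (by linarith) (by linarith)
  have hd := descartes_lt_three_mul_sum d a b c (by linarith) (by linarith)
  refine ⟨fun j => ?_, by linarith⟩
  fin_cases j <;> simp [SR, Matrix.mulVec, dotProduct, Fin.sum_univ_four] <;> linarith
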